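/- Let p > 1 and T > 0, and let X_0 := {u ∈ W^{1,p}(-T,T) : u is non-decreasing, ∫_{-T}^T |u(t)|^p dt = 1, and either u(-T) = 0 or u(T) = 0}. Then λ^+_p(-T,T) = inf{∫_{-T}^T ((u'(t))^+)^p dt : u ∈ X_0}. -/

import Mathlib

open MeasureTheory Filter Set
open scoped Topology RealInnerProductSpace

noncomputable section

/-- Positive part. -/
def ppart (t : ℝ) : ℝ := max t 0
/-- Negative part. -/
def npart (t : ℝ) : ℝ := max (-t) 0

/-- `u ∈ W^{1,p}(α,β)` (continuous representative on `[α,β]`), with weak derivative `u'`. -/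
def MemW1pC (p α β : ℝ) (u u' : ℝ → ℝ) : Prop :=
  IntervalIntegrable u' volume α β ∧
  (∀ t ∈ Set.Icc α β, u t = u α + ∫ s in α..t, u' s) ∧
  IntegrableOn (fun t => |u' t| ^ p) (Set.Ioo α β) volume

/-- `u ∈ W^{1,p}_0(α,β)`, with weak derivative `u'`. -/
def MemW1p0 (p α β : ℝ) (u u' : ℝ → ℝ) : Prop :=
  MemW1pC p α β u u' ∧ u α = 0 ∧ u β = 0

/-- `u ∈ W^{1,p}(α,β)` (interior version: no constraint at endpoints). -/
def MemW1pI (p α β : ℝ) (u u' : ℝ → ℝ) : Prop :=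
  IntervalIntegrable u' volume α β ∧
  (∀ s ∈ Set.Ioo α β, ∀ t ∈ Set.Ioo α β, u t = u s + ∫ r in s..t, u' r) ∧
  IntegrableOn (fun t => |u' t| ^ p) (Set.Ioo α β) volume

/-- `λ_p^H(α,β)` for a one-dimensional anisotropy `H`. -/
def lamH1 (p : ℝ) (H : ℝ → ℝ) (α β : ℝ) : ℝ :=
  sInf { E | ∃ u u', MemW1p0 p α β u u' ∧ (∫ t in Set.Ioo α β, |u t| ^ p) = 1 ∧
    E = ∫ t in Set.Ioo α β, H (u' t) ^ p }

/-- `λ_{1,p}(α,β)`, the principal Dirichlet eigenvalue of the 1d `p`-Laplacian. -/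
def lam1 (p α β : ℝ) : ℝ := lamH1 p (fun t => |t|) α β

/-- `λ_p^{a,b}(α,β)`. -/
def lamAB (p a b α β : ℝ) : ℝ := lamH1 p (fun t => a * ppart t + b * npart t) α β

/-- `λ_p^+(-T,T)`. -/
def lamPlus (p T : ℝ) : ℝ := lamH1 p ppart (-T) T

/-- `φ` is the (normalized positive) principal eigenfunction of the 1d `p`-Laplacian
on `(-T,T)`, with weak derivative `φ'`. -/
def IsPrincipalEigenfunction (p T : ℝ) (φ φ' : ℝ → ℝ) : Prop :=
  MemW1p0 p (-T) T φ φ' ∧ (∀ t ∈ Set.Ioo (-T) T, 0 < φ t) ∧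
  (∫ t in Set.Ioo (-T) T, |φ t| ^ p) = 1 ∧
  (∫ t in Set.Ioo (-T) T, |φ' t| ^ p) = lam1 p (-T) T

/-- The piecewise Sobolev class `W_pw^{1,p,+}(-T,T)`. -/
def MemWpw (p T : ℝ) (u u' : ℝ → ℝ) : Prop :=
  ∃ (m : ℕ) (P : ℕ → ℝ), 0 < m ∧ P 0 = -T ∧ P m = T ∧
    (∀ i < m, P i < P (i + 1)) ∧
    (∀ i < m, MemW1pI p (P i) (P (i + 1)) u u') ∧
    (∃ l₀, Tendsto u (𝓝[>] (-T)) (𝓝 l₀) ∧ l₀ ≤ 0) ∧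
    (∃ l₁, Tendsto u (𝓝[<] T) (𝓝 l₁) ∧ 0 ≤ l₁) ∧
    (∀ i, 0 < i → i < m → ∃ lm lp, Tendsto u (𝓝[<] (P i)) (𝓝 lm) ∧
      Tendsto u (𝓝[>] (P i)) (𝓝 lp) ∧ lp < lm)

/-! ### Two dimensions -/

/-- The Euclidean plane. -/
abbrev V2 := EuclideanSpace ℝ (Fin 2)

/-- The point of `ℝ²` with coordinates `(x, y)`. -/
def mk2 (x y : ℝ) : V2 := (EuclideanSpace.equiv (Fin 2) ℝ).symm ![x, y]

/-- An asymmetric anisotropy: nonnegative, convex and positively 1-homogeneous. -/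
def IsAnisotropy (H : V2 → ℝ) : Prop :=
  (∀ v, 0 ≤ H v) ∧ ConvexOn ℝ Set.univ H ∧ ∀ t : ℝ, 0 < t → ∀ v : V2, H (t • v) = t * H v

/-- A bounded domain of `ℝ²`. -/
def IsBoundedDomain (Ω : Set V2) : Prop :=
  IsOpen Ω ∧ IsConnected Ω ∧ Bornology.IsBounded Ω

/-- Smooth compactly supported test function on `Ω`. -/
def TestFun2 (Ω : Set V2) (φ : V2 → ℝ) : Prop :=
  ContDiff ℝ (⊤ : ℕ∞) φ ∧ HasCompactSupport φ ∧ tsupport φ ⊆ Ω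

/-- `u ∈ W^{1,p}_0(Ω)`, with weak gradient `g`: `u` and `g` are `p`-integrable on `Ω`
and approximable in `W^{1,p}`-norm by smooth functions compactly supported in `Ω`. -/
def MemW1p02 (p : ℝ) (Ω : Set V2) (u : V2 → ℝ) (g : V2 → V2) : Prop :=
  IntegrableOn (fun x => |u x| ^ p) Ω volume ∧
  IntegrableOn (fun x => ‖g x‖ ^ p) Ω volume ∧
  ∃ φ : ℕ → V2 → ℝ, (∀ n, TestFun2 Ω (φ n)) ∧
    Tendsto (fun n => ∫ x in Ω, |u x - φ n x| ^ p) atTop (𝓝 0) ∧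
    Tendsto (fun n => ∫ x in Ω, ‖g x - gradient (φ n) x‖ ^ p) atTop (𝓝 0)

/-- The least anisotropic energy level `λ_p^H(Ω)`. -/
def lamH (p : ℝ) (H : V2 → ℝ) (Ω : Set V2) : ℝ :=
  sInf { E | ∃ u g, MemW1p02 p Ω u g ∧ (∫ x in Ω, |u x| ^ p) = 1 ∧
    E = ∫ x in Ω, H (g x) ^ p }

/-- `λ_p^H(Ω)` is a fundamental frequency of `-Δ_p^H` on `Ω`. -/
def IsFundFreq (p : ℝ) (H : V2 → ℝ) (Ω : Set V2) : Prop :=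
  ∃ u g, MemW1p02 p Ω u g ∧ ¬ (∀ᵐ x ∂(volume.restrict Ω), u x = 0) ∧
    (∀ᵐ x ∂(volume.restrict Ω), DifferentiableAt ℝ H (g x)) ∧
    AEMeasurable (fun x => gradient H (g x)) (volume.restrict Ω) ∧
    ∀ φ gφ, MemW1p02 p Ω φ gφ →
      (∫ x in Ω, H (g x) ^ (p - 1) * ⟪gradient H (g x), gφ x⟫) =
        lamH p H Ω * ∫ x in Ω, |u x| ^ (p - 2) * u x * φ x

/-- The infimum `λ_p^H(Ω)` is attained by a (normalized, hence nonzero) function. -/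
def IsAttained (p : ℝ) (H : V2 → ℝ) (Ω : Set V2) : Prop :=
  ∃ u g, MemW1p02 p Ω u g ∧ (∫ x in Ω, |u x| ^ p) = 1 ∧
    (∫ x in Ω, H (g x) ^ p) = lamH p H Ω

/-- `‖H‖ := max {H v : |v| = 1}`. -/
def normH (H : V2 → ℝ) : ℝ := sSup (H '' Metric.sphere 0 1)

/-- A rotation: a linear isometry with positive determinant. -/
def IsRotation (A : V2 ≃ₗᵢ[ℝ] V2) : Prop :=
  0 < LinearMap.det (A.toLinearEquiv : V2 →ₗ[ℝ] V2)

/-- The kernel of an anisotropy. -/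
def kerH (H : V2 → ℝ) : Set V2 := {v | H v = 0}

/-- `S` is a line through the origin. -/
def IsLine (S : Set V2) : Prop := ∃ v : V2, v ≠ 0 ∧ S = {w | ∃ t : ℝ, w = t • v}

/-- `S` is a closed half-plane bounded by a line through the origin. -/
def IsClosedHalfPlane (S : Set V2) : Prop := ∃ v : V2, v ≠ 0 ∧ S = {w | ⟪v, w⟫ ≤ 0}

/-- Smooth compactly supported test function on an open set `S ⊆ ℝ`. -/
def TestFun1 (S : Set ℝ) (φ : ℝ → ℝ) : Prop :=
  ContDiff ℝ (⊤ : ℕ∞) φ ∧ HasCompactSupport φ ∧ tsupport φ ⊆ S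

/-- `v ∈ W^{1,p}_0(S)` for an open set `S ⊆ ℝ`, with weak derivative `v'`. -/
def MemW1p0S (p : ℝ) (S : Set ℝ) (v v' : ℝ → ℝ) : Prop :=
  IntegrableOn (fun t => |v t| ^ p) S volume ∧
  IntegrableOn (fun t => |v' t| ^ p) S volume ∧
  ∃ φ : ℕ → ℝ → ℝ, (∀ n, TestFun1 S (φ n)) ∧
    Tendsto (fun n => ∫ t in S, |v t - φ n t| ^ p) atTop (𝓝 0) ∧
    Tendsto (fun n => ∫ t in S, |v' t - deriv (φ n) t| ^ p) atTop (𝓝 0)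

/-- A bounded domain with Lipschitz (`C^{0,1}`) boundary: near each boundary point, after a
rigid motion, `Ω` is the region above the graph of a Lipschitz function. -/
def IsC01Domain (Ω : Set V2) : Prop :=
  IsBoundedDomain Ω ∧
  ∀ z ∈ frontier Ω, ∃ (A : V2 ≃ₗᵢ[ℝ] V2) (r K : ℝ) (f : ℝ → ℝ), 0 < r ∧ 0 ≤ K ∧
    LipschitzWith (Real.toNNReal K) f ∧
    ∀ v ∈ Metric.ball z r, (v ∈ Ω ↔ f ((A (v - z)) 0) < (A (v - z)) 1)

/-- The supremal length of a vertical open segment contained in `D`. -/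
def vertWidth (D : Set V2) : ℝ :=
  sSup {l : ℝ | ∃ x c : ℝ, ∀ y ∈ Set.Ioo c (c + l), mk2 x y ∈ D}

/-- The width function `L_θ` of `Ω` in direction `θ`. -/
def widthFn (Ω : Set V2) (θ : ℝ) : ℝ :=
  sSup {l : ℝ | ∃ (v : V2) (t0 : ℝ),
    ∀ t ∈ Set.Ioo t0 (t0 + l), v + t • mk2 (Real.cos θ) (Real.sin θ) ∈ Ω}

/-- The variational `p`-capacity of `K` relative to `B`. -/
def pCap (p : ℝ) (K B : Set V2) : ℝ :=
  sInf { E | ∃ φ : V2 → ℝ, ContDiff ℝ (⊤ : ℕ∞) φ ∧ HasCompactSupport φ ∧ tsupport φ ⊆ B ∧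
    (∀ x ∈ K, 1 ≤ φ x) ∧ E = ∫ x, ‖gradient φ x‖ ^ p }

/-- The Wiener criterion for the `p`-Laplacian at a boundary point `z`:
the Wiener integral diverges. -/
def WienerRegularAt (p : ℝ) (Ω : Set V2) (z : V2) : Prop :=
  ¬ IntegrableOn (fun t =>
      (pCap p (Metric.closedBall z t \ Ω) (Metric.ball z (2 * t)) /
        pCap p (Metric.closedBall z t) (Metric.ball z (2 * t))) ^ (1 / (p - 1)) / t)
    (Set.Ioo (0 : ℝ) 1) volume

/-- The optimal lower spectral constant `Λ^min(Ω)`. -/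
def LambdaMin (p : ℝ) (Ω : Set V2) : ℝ :=
  sInf {lam : ℝ | ∃ H : V2 → ℝ, IsAnisotropy H ∧ normH H = 1 ∧ IsFundFreq p H Ω ∧
    lam = lamH p H Ω}

end

noncomputable section

lemma ppart_nonneg (x : ℝ) : 0 ≤ ppart x := le_max_right _ _

lemma le_ppart (x : ℝ) : x ≤ ppart x := le_max_left _ _

lemma ppart_le_abs (x : ℝ) : ppart x ≤ |x| := max_le (le_abs_self x) (abs_nonneg x)

lemma ppart_ppart (x : ℝ) : ppart (ppart x) = ppart x := max_eq_left (ppart_nonneg x)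

lemma ppart_mul {c : ℝ} (hc : 0 ≤ c) (x : ℝ) : ppart (c * x) = c * ppart x := by
  simp [ppart, mul_max_of_nonneg _ _ hc]

lemma ppart_of_nonpos {x : ℝ} (hx : x ≤ 0) : ppart x = 0 := max_eq_right hx

lemma measurable_ppart : Measurable ppart := measurable_id.max measurable_const

lemma setIntegral_Ioo_eq {α β : ℝ} (h : α ≤ β) (f : ℝ → ℝ) :
    ∫ t in Ioo α β, f t = ∫ t in α..β, f t := by
  rw [intervalIntegral.integral_of_le h, integral_Ioc_eq_integral_Ioo]

lemma setIntegral_Ioo_comp_neg {T : ℝ} (hT : 0 < T) (f : ℝ → ℝ) :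
    ∫ t in Ioo (-T) T, f (-t) = ∫ t in Ioo (-T) T, f t := by
  rw [setIntegral_Ioo_eq (by linarith), setIntegral_Ioo_eq (by linarith),
    intervalIntegral.integral_comp_neg, neg_neg]

lemma integral_ppart_rpow_nonneg (p α β : ℝ) (g : ℝ → ℝ) :
    0 ≤ ∫ t in Ioo α β, ppart (g t) ^ p :=
  integral_nonneg fun _ => Real.rpow_nonneg (ppart_nonneg _) _

namespace MemW1pC

variable {p α β : ℝ} {u u' : ℝ → ℝ}

lemma continuousOn (h : MemW1pC p α β u u') (hαβ : α ≤ β) : ContinuousOn u (Icc α β) := by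
  have h1 := intervalIntegral.continuousOn_primitive_interval' h.1 left_mem_uIcc
  rw [uIcc_of_le hαβ] at h1
  exact (continuousOn_const.add h1).congr h.2.1

lemma integrableOn_deriv (h : MemW1pC p α β u u') (hαβ : α ≤ β) :
    IntegrableOn u' (Ioo α β) :=
  (intervalIntegrable_iff_integrableOn_Ioo_of_le hαβ).1 h.1

lemma intervalIntegrable_abs_rpow (h : MemW1pC p α β u u') (hαβ : α ≤ β) (hp : 0 ≤ p) :
    IntervalIntegrable (fun t => |u t| ^ p) volume α β := by
  refine ContinuousOn.intervalIntegrable ?_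
  rw [uIcc_of_le hαβ]
  exact (h.continuousOn hαβ).abs.rpow_const fun _ _ => Or.inr hp

lemma integrableOn_abs_rpow (h : MemW1pC p α β u u') (hαβ : α ≤ β) (hp : 0 ≤ p) :
    IntegrableOn (fun t => |u t| ^ p) (Ioo α β) :=
  (intervalIntegrable_iff_integrableOn_Ioo_of_le hαβ).1 (h.intervalIntegrable_abs_rpow hαβ hp)

lemma integrableOn_ppart_rpow (h : MemW1pC p α β u u') (hαβ : α ≤ β) (hp : 0 ≤ p) :
    IntegrableOn (fun t => ppart (u' t) ^ p) (Ioo α β) := by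
  refine h.2.2.mono' ?_ (ae_of_all _ fun t => ?_)
  · exact ((measurable_ppart.comp_aemeasurable
      (h.integrableOn_deriv hαβ).aemeasurable).pow_const p).aestronglyMeasurable
  · rw [Real.norm_eq_abs, abs_of_nonneg (Real.rpow_nonneg (ppart_nonneg _) _)]
    exact Real.rpow_le_rpow (ppart_nonneg _) (ppart_le_abs _) hp

lemma of_deriv {g : ℝ → ℝ} (hg : IntervalIntegrable g volume α β)
    (hgp : IntegrableOn (fun t => |g t| ^ p) (Ioo α β)) :
    MemW1pC p α β (fun t => ∫ s in α..t, g s) g :=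
  ⟨hg, fun t _ => by simp, hgp⟩

lemma const_mul (h : MemW1pC p α β u u') {c : ℝ} (hc : 0 ≤ c) :
    MemW1pC p α β (fun t => c * u t) (fun t => c * u' t) := by
  refine ⟨h.1.const_mul c, fun t ht => ?_, ?_⟩
  · beta_reduce
    rw [h.2.1 t ht, intervalIntegral.integral_const_mul]
    ring
  · refine IntegrableOn.congr_fun (h.2.2.const_mul (c ^ p)) (fun t _ => ?_) measurableSet_Ioo
    simp only [abs_mul, abs_of_nonneg hc]
    rw [Real.mul_rpow hc (abs_nonneg _)]

lemma integral_sub (h : MemW1pC p α β u u') {s t : ℝ} (hs : s ∈ Icc α β) (ht : t ∈ Icc α β) :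
    u t - u s = ∫ r in s..t, u' r := by
  have hi : ∀ x ∈ Icc α β, IntervalIntegrable u' volume α x := fun x hx =>
    h.1.mono_set (by
      rw [uIcc_of_le hx.1, uIcc_of_le (hx.1.trans hx.2)]
      exact Icc_subset_Icc_right hx.2)
  rw [h.2.1 t ht, h.2.1 s hs, ← intervalIntegral.integral_interval_sub_left (hi t ht) (hi s hs)]
  ring

lemma reflect {T : ℝ} (hT : 0 < T) (h : MemW1pC p (-T) T u u') :
    MemW1pC p (-T) T (fun t => -u (-t)) (fun t => u' (-t)) := by
  have hneg : ∀ {f : ℝ → ℝ}, IntervalIntegrable f volume (-T) T →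
      IntervalIntegrable (fun t => f (-t)) volume (-T) T := fun hf => by
    simpa using ((IntervalIntegrable.iff_comp_neg (by simp)).1 hf).symm
  have hle : -T ≤ T := by linarith
  refine ⟨hneg h.1, fun t ht => ?_, ?_⟩
  · have := h.integral_sub (s := -t) (t := T) ⟨by linarith [ht.2], by linarith [ht.1]⟩ ⟨hle, le_rfl⟩
    beta_reduce
    rw [intervalIntegral.integral_comp_neg, neg_neg, ← this]
    ring
  · rw [← intervalIntegrable_iff_integrableOn_Ioo_of_le hle]
    exact hneg ((intervalIntegrable_iff_integrableOn_Ioo_of_le hle).2 h.2.2)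

/-- Rescaling a function to unit `L^p` norm divides its energy by the `p`-th power of its norm. -/
lemma exists_normalized (hp : 0 < p) (h : MemW1pC p α β u u')
    (hN : 0 < ∫ t in Ioo α β, |u t| ^ p) :
    ∃ c : ℝ, 0 < c ∧ MemW1pC p α β (fun t => c * u t) (fun t => c * u' t) ∧
      (∫ t in Ioo α β, |c * u t| ^ p) = 1 ∧
      (∫ t in Ioo α β, ppart (c * u' t) ^ p) =
        (∫ t in Ioo α β, ppart (u' t) ^ p) / ∫ t in Ioo α β, |u t| ^ p := by
  set N := ∫ t in Ioo α β, |u t| ^ p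
  have hc : 0 < (N⁻¹) ^ p⁻¹ := Real.rpow_pos_of_pos (inv_pos.2 hN) _
  have hcp : ((N⁻¹) ^ p⁻¹) ^ p = N⁻¹ := Real.rpow_inv_rpow (inv_pos.2 hN).le hp.ne'
  refine ⟨(N⁻¹) ^ p⁻¹, hc, h.const_mul hc.le, ?_, ?_⟩
  · simp only [abs_mul, abs_of_pos hc, Real.mul_rpow hc.le (abs_nonneg _), hcp]
    rw [integral_const_mul]
    exact inv_mul_cancel₀ hN.ne'
  · simp only [ppart_mul hc.le, Real.mul_rpow hc.le (ppart_nonneg _), hcp]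
    rw [integral_const_mul, div_eq_inv_mul]

lemma monotoneOn_of_deriv_nonneg (h : MemW1pC p α β u u') (hu' : ∀ t, 0 ≤ u' t) :
    MonotoneOn u (Icc α β) := fun s hs t ht hst => by
  rw [← sub_nonneg, h.integral_sub hs ht]
  exact intervalIntegral.integral_nonneg hst fun x _ => hu' x

/-- A function vanishing at `α` has its positive part dominated by a non-decreasing function
vanishing at `α`, whose energy is the one of `u` on the set where `u` is positive. -/
lemma exists_monotone_majorant (hp : 0 < p) (hαβ : α < β) (h : MemW1pC p α β u u')
    (hα : u α = 0) :
    ∃ v v', MemW1pC p α β v v' ∧ MonotoneOn v (Icc α β) ∧ v α = 0 ∧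
      (∫ t in Ioo α β, ppart (v' t) ^ p) =
        ∫ t in Ioo α β ∩ {t | 0 < u t}, ppart (u' t) ^ p ∧
      ∫ t in Ioo α β ∩ {t | 0 < u t}, |u t| ^ p ≤ ∫ t in Ioo α β, |v t| ^ p := by
  have hcont := h.continuousOn hαβ.le
  have hS : MeasurableSet (Ioo α β ∩ {t | 0 < u t}) :=
    ((hcont.mono Ioo_subset_Icc_self).isOpen_inter_preimage isOpen_Ioo isOpen_Ioi).measurableSet
  set S := Ioo α β ∩ {t | 0 < u t} with hSdef
  set g : ℝ → ℝ := S.indicator fun t => ppart (u' t) with hg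
  have hg0 : ∀ t, 0 ≤ g t := fun t => indicator_nonneg (fun _ _ => ppart_nonneg _) t
  have hgu : ∀ t, |g t| ≤ |u' t| := fun t => by
    rw [abs_of_nonneg (hg0 t)]
    exact indicator_apply_le' (fun _ => ppart_le_abs _) fun _ => abs_nonneg _
  have hgm : AEMeasurable g (volume.restrict (Ioo α β)) :=
    (measurable_ppart.comp_aemeasurable (h.integrableOn_deriv hαβ.le).aemeasurable).indicator hS
  have hgi : IntervalIntegrable g volume α β := by
    rw [intervalIntegrable_iff_integrableOn_Ioo_of_le hαβ.le]
    exact Integrable.mono (h.integrableOn_deriv hαβ.le) hgm.aestronglyMeasurable (ae_of_all _ hgu)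
  have hgp : IntegrableOn (fun t => |g t| ^ p) (Ioo α β) := by
    refine h.2.2.mono' ((hgm.abs.pow_const p).aestronglyMeasurable) (ae_of_all _ fun t => ?_)
    rw [Real.norm_eq_abs, abs_of_nonneg (Real.rpow_nonneg (abs_nonneg _) _)]
    exact Real.rpow_le_rpow (abs_nonneg _) (hgu t) hp.le
  have hv := of_deriv hgi hgp
  have hdom : ∀ t ∈ S, u t ≤ ∫ s in α..t, g s := by
    rintro t ⟨ht, htpos⟩
    have htc := Ioo_subset_Icc_self ht
    obtain ⟨s, ⟨hs, hs0⟩, hsmax⟩ : ∃ s, IsGreatest (Icc α t ∩ u ⁻¹' Iic 0) s := by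
      refine IsCompact.exists_isGreatest ?_ ⟨α, ⟨le_rfl, ht.1.le⟩, hα.le⟩
      exact isCompact_Icc.of_isClosed_subset
        ((hcont.mono (Icc_subset_Icc_right ht.2.le)).preimage_isClosed_of_isClosed
          isClosed_Icc isClosed_Iic) inter_subset_left
    have hsc : s ∈ Icc α β := ⟨hs.1, hs.2.trans ht.2.le⟩
    have hsub : uIcc s t ⊆ uIcc α β := by
      rw [uIcc_of_le hs.2, uIcc_of_le hαβ.le]
      exact Icc_subset_Icc hs.1 ht.2.le
    have hsub' : uIcc α t ⊆ uIcc α β := by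
      rw [uIcc_of_le ht.1.le, uIcc_of_le hαβ.le]
      exact Icc_subset_Icc_right ht.2.le
    calc u t ≤ u t - u s := by linarith [show u s ≤ 0 from hs0]
      _ = ∫ r in s..t, u' r := h.integral_sub hsc htc
      _ ≤ ∫ r in s..t, g r := by
        refine intervalIntegral.integral_mono_on_of_le_Ioo hs.2 (h.1.mono_set hsub)
          (hgi.mono_set hsub) fun r hr => ?_
        have hrS : r ∈ S := by
          refine ⟨⟨hs.1.trans_lt hr.1, hr.2.trans ht.2⟩, ?_⟩
          by_contra hneg
          have hur : u r ≤ 0 := not_lt.1 hneg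
          exact absurd (hsmax ⟨⟨hs.1.trans hr.1.le, hr.2.le⟩, hur⟩) (not_le.2 hr.1)
        rw [hg, indicator_of_mem hrS]
        exact le_ppart _
      _ ≤ ∫ r in α..t, g r :=
        intervalIntegral.integral_mono_interval hs.1 hs.2 le_rfl (ae_of_all _ hg0)
          (hgi.mono_set hsub')
  refine ⟨_, g, hv, hv.monotoneOn_of_deriv_nonneg hg0, by simp, ?_, ?_⟩
  · have : (fun t => ppart (g t) ^ p) = S.indicator fun t => ppart (u' t) ^ p := by
      ext t
      by_cases ht : t ∈ S
      · simp [hg, ht, ppart_ppart]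
      · simp [hg, ht, ppart, Real.zero_rpow hp.ne']
    rw [this, setIntegral_indicator hS, hSdef, ← inter_assoc, inter_self]
  · have hvi := hv.integrableOn_abs_rpow hαβ.le hp.le
    calc ∫ t in S, |u t| ^ p ≤ ∫ t in S, |∫ s in α..t, g s| ^ p := by
          refine setIntegral_mono_on ((h.integrableOn_abs_rpow hαβ.le hp.le).mono_set
            inter_subset_left) (hvi.mono_set inter_subset_left) hS fun t ht => ?_
          refine Real.rpow_le_rpow (abs_nonneg _) (abs_le_abs_of_nonneg ?_ (hdom t ht)) hp.le
          exact le_of_lt ht.2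
      _ ≤ ∫ t in Ioo α β, |∫ s in α..t, g s| ^ p :=
          setIntegral_mono_set hvi
            (ae_of_all _ fun t => Real.rpow_nonneg (abs_nonneg _) _)
            inter_subset_left.eventuallyLE

/-- A nonnegative function vanishing at `α` can be cut off linearly on `(s, β)` without
increasing its energy. -/
lemma exists_cutoff (hp : 0 < p) (h : MemW1pC p α β u u') (hα : u α = 0)
    {s : ℝ} (hs : s ∈ Ioo α β) (hus : 0 ≤ u s) :
    ∃ v v', MemW1p0 p α β v v' ∧
      (∫ t in Ioo α β, ppart (v' t) ^ p) ≤ ∫ t in Ioo α β, ppart (u' t) ^ p ∧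
      ∫ t in α..s, |u t| ^ p ≤ ∫ t in Ioo α β, |v t| ^ p := by
  have hαβ : α ≤ β := (hs.1.trans hs.2).le
  have hsβ : 0 < β - s := sub_pos.2 hs.2
  have hsub : uIcc α s ⊆ uIcc α β := by
    rw [uIcc_of_le hs.1.le, uIcc_of_le hαβ]
    exact Icc_subset_Icc_right hs.2.le
  set c := -(u s / (β - s)) with hc
  set g : ℝ → ℝ := fun t => if t ≤ s then u' t else c with hg
  have hgl : ∀ t ∈ uIoc α s, g t = u' t := fun t ht => by
    rw [uIoc_of_le hs.1.le] at ht
    simp [hg, ht.2]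
  have hgr : ∀ t ∈ uIoc s β, g t = c := fun t ht => by
    rw [uIoc_of_le hs.2.le] at ht
    simp [hg, ht.1]
  have hcomp : ∀ F : ℝ → ℝ, IntervalIntegrable (fun t => F (u' t)) volume α β →
      IntervalIntegrable (fun t => F (g t)) volume α s ∧
      IntervalIntegrable (fun t => F (g t)) volume s β := fun F hF =>
    ⟨(hF.mono_set hsub).congr fun t ht => by simp only [hgl t ht],
      (intervalIntegrable_const (c := F c)).congr fun t ht => by simp only [hgr t ht]⟩
  have hgi : IntervalIntegrable g volume α s ∧ IntervalIntegrable g volume s β := hcomp id h.1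
  have hgp := hcomp (fun x => |x| ^ p)
    ((intervalIntegrable_iff_integrableOn_Ioo_of_le hαβ).2 h.2.2)
  have hEi := (intervalIntegrable_iff_integrableOn_Ioo_of_le hαβ).2
    (h.integrableOn_ppart_rpow hαβ hp.le)
  have hge := hcomp (fun x => ppart x ^ p) hEi
  have hv : MemW1pC p α β (fun t => ∫ r in α..t, g r) g :=
    of_deriv (hgi.1.trans hgi.2)
      ((intervalIntegrable_iff_integrableOn_Ioo_of_le hαβ).1 (hgp.1.trans hgp.2))
  have hvu : ∀ t ∈ Icc α s, ∫ r in α..t, g r = u t := fun t ht => by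
    rw [h.2.1 t ⟨ht.1, ht.2.trans hs.2.le⟩, hα, zero_add]
    refine intervalIntegral.integral_congr_ae (ae_of_all _ fun r hr => hgl r ?_)
    rw [uIoc_of_le ht.1] at hr
    rw [uIoc_of_le hs.1.le]
    exact ⟨hr.1, hr.2.trans ht.2⟩
  refine ⟨_, g, ⟨hv, by simp, ?_⟩, ?_, ?_⟩
  · rw [← intervalIntegral.integral_add_adjacent_intervals hgi.1 hgi.2]
    rw [hvu s ⟨hs.1.le, le_rfl⟩, intervalIntegral.integral_congr_ae (ae_of_all _ hgr),
      intervalIntegral.integral_const, smul_eq_mul, hc]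
    field_simp
    ring
  · rw [setIntegral_Ioo_eq hαβ, setIntegral_Ioo_eq hαβ,
      ← intervalIntegral.integral_add_adjacent_intervals hge.1 hge.2]
    have h1 : ∫ t in α..s, ppart (g t) ^ p = ∫ t in α..s, ppart (u' t) ^ p :=
      intervalIntegral.integral_congr_ae (ae_of_all _ fun r hr => by rw [hgl r hr])
    have h2 : ∫ t in s..β, ppart (g t) ^ p = ∫ t in s..β, (0 : ℝ) :=
      intervalIntegral.integral_congr_ae (ae_of_all _ fun r hr => by
        rw [hgr r hr, ppart_of_nonpos (neg_nonpos.2 (div_nonneg hus hsβ.le)),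
          Real.zero_rpow hp.ne'])
    rw [h1, h2, intervalIntegral.integral_zero, add_zero]
    exact intervalIntegral.integral_mono_interval le_rfl hs.1.le hs.2.le
      (ae_of_all _ fun t => Real.rpow_nonneg (ppart_nonneg _) _) hEi
  · rw [setIntegral_Ioo_eq hαβ]
    have h1 : ∫ t in α..s, |u t| ^ p = ∫ t in α..s, |∫ r in α..t, g r| ^ p :=
      intervalIntegral.integral_congr_ae (ae_of_all _ fun t ht => by
        rw [uIoc_of_le hs.1.le] at ht
        rw [hvu t ⟨ht.1.le, ht.2⟩])
    rw [h1]
    exact intervalIntegral.integral_mono_interval le_rfl hs.1.le hs.2.le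
      (ae_of_all _ fun t => Real.rpow_nonneg (abs_nonneg _) _)
      (hv.intervalIntegrable_abs_rpow hαβ hp.le)

end MemW1pC

/-- The energies of normalized functions in `W^{1,p}_0(α,β)`. -/
def dirichletEnergies (p α β : ℝ) : Set ℝ :=
  { E | ∃ u u', MemW1p0 p α β u u' ∧ (∫ t in Ioo α β, |u t| ^ p) = 1 ∧
    E = ∫ t in Ioo α β, ppart (u' t) ^ p }

/-- The energies of normalized non-decreasing functions vanishing at one endpoint. -/
def monotoneEnergies (p α β : ℝ) : Set ℝ :=
  { E | ∃ u u', MemW1pC p α β u u' ∧ MonotoneOn u (Icc α β) ∧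
    (∫ t in Ioo α β, |u t| ^ p) = 1 ∧ (u α = 0 ∨ u β = 0) ∧
    E = ∫ t in Ioo α β, ppart (u' t) ^ p }

lemma bddBelow_dirichletEnergies (p α β : ℝ) : BddBelow (dirichletEnergies p α β) :=
  ⟨0, by rintro _ ⟨u, u', -, -, rfl⟩; exact integral_ppart_rpow_nonneg p α β u'⟩

lemma bddBelow_monotoneEnergies (p α β : ℝ) : BddBelow (monotoneEnergies p α β) :=
  ⟨0, by rintro _ ⟨u, u', -, -, -, -, rfl⟩; exact integral_ppart_rpow_nonneg p α β u'⟩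

lemma div_mem_monotoneEnergies {p α β : ℝ} {u u' : ℝ → ℝ} (hp : 0 < p)
    (h : MemW1pC p α β u u') (hmono : MonotoneOn u (Icc α β)) (hα : u α = 0)
    (hN : 0 < ∫ t in Ioo α β, |u t| ^ p) :
    (∫ t in Ioo α β, ppart (u' t) ^ p) / (∫ t in Ioo α β, |u t| ^ p) ∈
      monotoneEnergies p α β := by
  obtain ⟨c, hc, hm, h1, hE⟩ := h.exists_normalized hp hN
  exact ⟨_, _, hm, fun x hx y hy hxy => mul_le_mul_of_nonneg_left (hmono hx hy hxy) hc.le,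
    h1, Or.inl (by simp [hα]), hE.symm⟩

lemma div_mem_dirichletEnergies {p α β : ℝ} {u u' : ℝ → ℝ} (hp : 0 < p)
    (h : MemW1p0 p α β u u') (hN : 0 < ∫ t in Ioo α β, |u t| ^ p) :
    (∫ t in Ioo α β, ppart (u' t) ^ p) / (∫ t in Ioo α β, |u t| ^ p) ∈
      dirichletEnergies p α β := by
  obtain ⟨c, hc, hm, h1, hE⟩ := h.1.exists_normalized hp hN
  exact ⟨_, _, ⟨hm, by simp [h.2.1], by simp [h.2.2]⟩, h1, hE.symm⟩

lemma exists_div_le_of_add_le {E E₁ E₂ N₁ N₂ : ℝ} (hE₁ : 0 ≤ E₁) (hE₂ : 0 ≤ E₂)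
    (hN₁ : 0 ≤ N₁) (hN₂ : 0 ≤ N₂) (hE : E₁ + E₂ ≤ E) (hN : 1 ≤ N₁ + N₂) :
    (0 < N₁ ∧ E₁ / N₁ ≤ E) ∨ (0 < N₂ ∧ E₂ / N₂ ≤ E) := by
  have hE0 : 0 ≤ E := by linarith
  rcases hN₁.eq_or_lt with h₁ | h₁
  · have h₂ : 0 < N₂ := by linarith
    refine Or.inr ⟨h₂, ?_⟩
    rw [div_le_iff₀ h₂]
    nlinarith
  rcases hN₂.eq_or_lt with h₂ | h₂
  · refine Or.inl ⟨h₁, ?_⟩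
    rw [div_le_iff₀ h₁]
    nlinarith
  by_contra! hcon
  have a := hcon.1 h₁
  have b := hcon.2 h₂
  rw [lt_div_iff₀ h₁] at a
  rw [lt_div_iff₀ h₂] at b
  nlinarith

lemma exists_monotoneEnergies_le {p T : ℝ} (hp : 0 < p) (hT : 0 < T) {E : ℝ}
    (hE : E ∈ dirichletEnergies p (-T) T) : ∃ E' ∈ monotoneEnergies p (-T) T, E' ≤ E := by
  obtain ⟨u, u', ⟨h, hu0, hu1⟩, hN, rfl⟩ := hE
  have hlt : -T < T := by linarith
  obtain ⟨v, v', hv, hvm, hv0, hvE, hvN⟩ := h.exists_monotone_majorant hp hlt hu0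
  obtain ⟨w, w', hw, hwm, hw0, hwE, hwN⟩ :=
    (h.reflect hT).exists_monotone_majorant hp hlt (by simp [hu1])
  have hcont := h.continuousOn hlt.le
  have hP : MeasurableSet (Ioo (-T) T ∩ {t | 0 < u t}) :=
    ((hcont.mono Ioo_subset_Icc_self).isOpen_inter_preimage isOpen_Ioo isOpen_Ioi).measurableSet
  have hQ : MeasurableSet (Ioo (-T) T ∩ {t | u t < 0}) :=
    ((hcont.mono Ioo_subset_Icc_self).isOpen_inter_preimage isOpen_Ioo isOpen_Iio).measurableSet
  have hPQ : Disjoint (Ioo (-T) T ∩ {t | 0 < u t}) (Ioo (-T) T ∩ {t | u t < 0}) :=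
    disjoint_left.2 fun t ht ht' => lt_asymm (a := 0) (b := u t) ht.2 ht'.2
  have hrefl : ∀ f : ℝ → ℝ, ∫ t in Ioo (-T) T ∩ {t | 0 < -u (-t)}, f (-t) =
      ∫ t in Ioo (-T) T ∩ {t | u t < 0}, f t := fun f => by
    have hR : MeasurableSet (Ioo (-T) T ∩ {t | 0 < -u (-t)}) := by
      have hc := (h.reflect hT).continuousOn hlt.le
      exact ((hc.mono Ioo_subset_Icc_self).isOpen_inter_preimage isOpen_Ioo
        isOpen_Ioi).measurableSet
    have h1 := setIntegral_indicator (μ := volume) (s := Ioo (-T) T)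
      (f := fun t => f (-t)) hR
    have h2 := setIntegral_indicator (μ := volume) (s := Ioo (-T) T) (f := f) hQ
    rw [← inter_assoc, inter_self] at h1 h2
    rw [← h1, ← h2, ← setIntegral_Ioo_comp_neg hT (indicator _ f)]
    congr 1
    ext t
    have hiff : t ∈ Ioo (-T) T ∩ {t | 0 < -u (-t)} ↔ -t ∈ Ioo (-T) T ∩ {t | u t < 0} := by
      simp only [mem_inter_iff, mem_Ioo, mem_ofPred_eq, neg_pos]
      constructor <;> rintro ⟨⟨h1, h2⟩, h3⟩ <;> exact ⟨⟨by linarith, by linarith⟩, h3⟩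
    by_cases ht : t ∈ Ioo (-T) T ∩ {t | 0 < -u (-t)}
    · rw [indicator_of_mem ht, indicator_of_mem (hiff.1 ht)]
    · rw [indicator_of_notMem ht, indicator_of_notMem (mt hiff.2 ht)]
  rw [hrefl fun t => ppart (u' t) ^ p] at hwE
  simp only [abs_neg] at hwN
  rw [hrefl fun t => |u t| ^ p] at hwN
  have hEi := h.integrableOn_ppart_rpow hlt.le hp.le
  have hNi := h.integrableOn_abs_rpow hlt.le hp.le
  have hEsum : (∫ t in Ioo (-T) T, ppart (v' t) ^ p) + (∫ t in Ioo (-T) T, ppart (w' t) ^ p) ≤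
      ∫ t in Ioo (-T) T, ppart (u' t) ^ p := by
    rw [hvE, hwE, ← setIntegral_union hPQ hQ (hEi.mono_set inter_subset_left)
      (hEi.mono_set inter_subset_left)]
    exact setIntegral_mono_set hEi
      (ae_of_all _ fun t => Real.rpow_nonneg (ppart_nonneg _) _)
      (union_subset inter_subset_left inter_subset_left).eventuallyLE
  have hNsum : 1 ≤ (∫ t in Ioo (-T) T, |v t| ^ p) + ∫ t in Ioo (-T) T, |w t| ^ p := by
    refine le_trans (le_of_eq ?_) (add_le_add hvN hwN)
    rw [← setIntegral_union hPQ hQ (hNi.mono_set inter_subset_left)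
      (hNi.mono_set inter_subset_left), ← hN]
    refine (setIntegral_eq_of_subset_of_forall_sdiff_eq_zero measurableSet_Ioo
      (union_subset inter_subset_left inter_subset_left) fun t ht => ?_)
    have hut : u t = 0 := by
      by_contra hne
      rcases lt_or_gt_of_ne hne with hlt | hgt
      · exact ht.2 (Or.inr ⟨ht.1, hlt⟩)
      · exact ht.2 (Or.inl ⟨ht.1, hgt⟩)
    simp [hut, Real.zero_rpow hp.ne']
  have hnn : ∀ f : ℝ → ℝ, 0 ≤ ∫ t in Ioo (-T) T, |f t| ^ p := fun f =>
    integral_nonneg fun _ => Real.rpow_nonneg (abs_nonneg _) _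
  rcases exists_div_le_of_add_le (integral_ppart_rpow_nonneg p (-T) T v')
    (integral_ppart_rpow_nonneg p (-T) T w') (hnn v) (hnn w) hEsum hNsum with ⟨h1, h2⟩ | ⟨h1, h2⟩
  · exact ⟨_, div_mem_monotoneEnergies hp hv hvm hv0 h1, h2⟩
  · exact ⟨_, div_mem_monotoneEnergies hp hw hwm hw0 h1, h2⟩

/-- A normalized non-decreasing function vanishing at `α` has an energy which is approximated by
energies of normalized functions vanishing at both endpoints. -/
lemma exists_dirichletEnergies_lt_of_left {p α β : ℝ} (hp : 0 < p) (hαβ : α < β)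
    {u u' : ℝ → ℝ} (h : MemW1pC p α β u u') (hmono : MonotoneOn u (Icc α β))
    (hN : (∫ t in Ioo α β, |u t| ^ p) = 1) (hα : u α = 0) {M : ℝ}
    (hM : ∫ t in Ioo α β, ppart (u' t) ^ p < M) : ∃ E' ∈ dirichletEnergies p α β, E' < M := by
  have hF : Tendsto (fun s => ∫ t in α..s, |u t| ^ p) (𝓝[<] β) (𝓝 1) := by
    have hc := intervalIntegral.continuousOn_primitive_interval'
      (h.intervalIntegrable_abs_rpow hαβ.le hp.le) left_mem_uIcc β right_mem_uIcc
    rw [ContinuousWithinAt, ← setIntegral_Ioo_eq hαβ.le, hN, uIcc_of_le hαβ.le] at hc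
    rw [← nhdsWithin_Ioo_eq_nhdsLT hαβ]
    exact hc.mono_left (nhdsWithin_mono _ Ioo_subset_Icc_self)
  have hlim := (tendsto_const_nhds (x := ∫ t in Ioo α β, ppart (u' t) ^ p)).div hF one_ne_zero
  rw [div_one] at hlim
  obtain ⟨s, ⟨hlt, hpos⟩, hs⟩ := (((hlim.eventually_lt_const hM).and
    (hF.eventually_const_lt zero_lt_one)).and (Ioo_mem_nhdsLT hαβ)).exists
  have hus : 0 ≤ u s := by
    rw [← hα]
    exact hmono ⟨le_rfl, hαβ.le⟩ (Ioo_subset_Icc_self hs) hs.1.le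
  obtain ⟨v, v', hv, hvE, hvN⟩ := h.exists_cutoff hp hα hs hus
  refine ⟨_, div_mem_dirichletEnergies hp hv (hpos.trans_le hvN), lt_of_le_of_lt ?_ hlt⟩
  exact div_le_div₀ (integral_ppart_rpow_nonneg p α β u') hvE hpos hvN

lemma exists_dirichletEnergies_lt {p T : ℝ} (hp : 0 < p) (hT : 0 < T) {E M : ℝ}
    (hE : E ∈ monotoneEnergies p (-T) T) (hM : E < M) :
    ∃ E' ∈ dirichletEnergies p (-T) T, E' < M := by
  obtain ⟨u, u', h, hmono, hN, h0 | h0, rfl⟩ := hE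
  · exact exists_dirichletEnergies_lt_of_left hp (by linarith) h hmono hN h0 hM
  · rw [← setIntegral_Ioo_comp_neg hT] at hM
    refine exists_dirichletEnergies_lt_of_left hp (by linarith) (h.reflect hT)
      (fun x hx y hy hxy => ?_) ?_ (by simp [h0]) hM
    · exact neg_le_neg (hmono ⟨by linarith [hy.2], by linarith [hy.1]⟩
        ⟨by linarith [hx.2], by linarith [hx.1]⟩ (neg_le_neg hxy))
    · simp only [abs_neg]
      rw [setIntegral_Ioo_comp_neg hT fun t => |u t| ^ p, hN]

theorem lamPlus_monotone (p T : ℝ) (hp : 1 < p) (hT : 0 < T) :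
    lamPlus p T = sInf { E | ∃ u u', MemW1pC p (-T) T u u' ∧
      MonotoneOn u (Set.Icc (-T) T) ∧
      (∫ t in Set.Ioo (-T) T, |u t| ^ p) = 1 ∧ (u (-T) = 0 ∨ u T = 0) ∧
      E = ∫ t in Set.Ioo (-T) T, ppart (u' t) ^ p } := by
  have hp0 : 0 < p := by linarith
  change sInf (dirichletEnergies p (-T) T) = sInf (monotoneEnergies p (-T) T)
  rcases (dirichletEnergies p (-T) T).eq_empty_or_nonempty with hA | hA
  · suffices hB : monotoneEnergies p (-T) T = ∅ by rw [hA, hB]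
    refine eq_empty_of_forall_notMem fun E hE => ?_
    obtain ⟨E', hE', -⟩ := exists_dirichletEnergies_lt hp0 hT hE (lt_add_one E)
    exact notMem_empty E' (hA ▸ hE')
  · obtain ⟨E₀, hE₀⟩ := hA
    obtain ⟨E₁, hE₁, -⟩ := exists_monotoneEnergies_le hp0 hT hE₀
    refine le_antisymm (le_csInf ⟨E₁, hE₁⟩ fun E hE => le_of_forall_gt fun M hM => ?_)
      (le_csInf ⟨E₀, hE₀⟩ fun E hE => ?_)
    · obtain ⟨E', hE', hlt⟩ := exists_dirichletEnergies_lt hp0 hT hE hM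
      exact (csInf_le (bddBelow_dirichletEnergies p (-T) T) hE').trans_lt hlt
    · obtain ⟨E', hE', hle⟩ := exists_monotoneEnergies_le hp0 hT hE
      exact (csInf_le (bddBelow_monotoneEnergies p (-T) T) hE').trans hle

end
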